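/- arXiv:1207.6778 — 2 statements merged into one kernel-verified Lean document; each statement's English description precedes it below -/
import Mathlib

section
/- Any set of 9 points in the plane in general position contains 5 points in convex position. -/
open scoped Classical
noncomputable section

/-- Points in the plane. -/
abbrev Pt := ℝ × ℝ

/-- Signed area determinant of the triple (p, q, r). -/
def det (p q r : Pt) : ℝ := (q.1 - p.1) * (r.2 - p.2) - (q.2 - p.2) * (r.1 - p.1)

/-- A finite point set is in general position if no three distinct points are collinear. -/
def GenPos (S : Finset Pt) : Prop :=
  ∀ p ∈ S, ∀ q ∈ S, ∀ r ∈ S, p ≠ q → p ≠ r → q ≠ r → ¬ Collinear ℝ ({p, q, r} : Set Pt)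

/-- A finite point set is in convex position if no point lies in the
convex hull of the others. -/
def ConvexPos (S : Finset Pt) : Prop :=
  ∀ p ∈ S, p ∉ convexHull ℝ ((S.erase p : Finset Pt) : Set Pt)

/-- The vertices of the convex hull of a finite point set. -/
def hullVerts (S : Finset Pt) : Finset Pt :=
  S.filter (fun p => p ∉ convexHull ℝ ((S.erase p : Finset Pt) : Set Pt))

/-- `S` is an empty convex pentagon of the point set `P`. -/
def EmptyConvexPentagon (P S : Finset Pt) : Prop :=
  S ⊆ P ∧ S.card = 5 ∧ ConvexPos S ∧
    ∀ p ∈ P, p ∉ S → p ∉ interior (convexHull ℝ (S : Set Pt))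

/-- Type-1 beam `a : bc`: the convex cone with apex `a` spanned by the rays from `a`
through `b` and through `c`, minus the triangle `abc`. -/
def beam1 (a b c : Pt) : Set Pt :=
  {x | (∃ s t : ℝ, 0 ≤ s ∧ 0 ≤ t ∧ x = a + s • (b - a) + t • (c - a)) ∧
       x ∉ convexHull ℝ ({a, b, c} : Set Pt)}

/-- Type-2 beam `pq : rs`: the convex region bounded by the segment `pq`, the ray
from `p` through `s` and the ray from `q` through `r`, minus the quadrilateral `pqrs`. -/
def beam2 (p q r s : Pt) : Set Pt :=
  {x | (∃ y ∈ segment ℝ p q, ∃ u v : ℝ, 0 ≤ u ∧ 0 ≤ v ∧ x = y + u • (s - p) + v • (r - q)) ∧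
       x ∉ convexHull ℝ ({p, q, r, s} : Set Pt)}

/-- The O-region of triangle `abc` opposite the vertex `a`: points separated from `a`
by line `bc`, on the same side of line `ac` as `b`, and on the same side of line `ab` as `c`. -/
def ORegionOpp (a b c : Pt) : Set Pt :=
  {x | det b c x * det b c a < 0 ∧ det a c x * det a c b > 0 ∧ det a b x * det a b c > 0}

/-- The I-region of triangle (or quadrilateral) at vertex `a` relative to the remaining
vertex set `R`: points `x` such that `a` lies strictly inside the convex hull of `{x} ∪ R`. -/
def IRegion (a : Pt) (R : Set Pt) : Set Pt :=
  {x | a ∈ interior (convexHull ℝ (insert x R))}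

/-- A convex quadrilateral with vertices `a b c d` in this cyclic order. -/
def CyclicQuad (a b c d : Pt) : Prop :=
  ConvexPos ({a, b, c, d} : Finset Pt) ∧ ({a, b, c, d} : Finset Pt).card = 4 ∧
    det a c b * det a c d < 0 ∧ det b d a * det b d c < 0

/-! ### Oriented triples -/

/-- The orientations of the triples of four points `a, b, c, d`, listed lexicographically, change
at most once. The propositions state that `abc`, `abd`, `acd`, `bcd` are counterclockwise. -/
structure Signotope (abc abd acd bcd : Prop) : Prop where
  abd_of_abc_acd : abc → acd → abd
  abd_of_abc_bcd : abc → bcd → abd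
  acd_of_abc_bcd : abc → bcd → acd
  acd_of_abd_bcd : abd → bcd → acd
  abc_or_acd : abd → abc ∨ acd
  abc_or_bcd_of_abd : abd → abc ∨ bcd
  abc_or_bcd_of_acd : acd → abc ∨ bcd
  abd_or_bcd : acd → abd ∨ bcd

/-- Four points in counterclockwise order around `o` form a signotope. -/
lemma signotope_of_det_pos {o a b c d : Pt} (hab : 0 < det o a b) (hac : 0 < det o a c)
    (had : 0 < det o a d) (hbc : 0 < det o b c) (hbd : 0 < det o b d) (hcd : 0 < det o c d) :
    Signotope (0 < det a b c) (0 < det a b d) (0 < det a c d) (0 < det b c d) := by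
  have no_alternation {x y z u v w : ℝ} (hu : 0 < u) (hv : 0 < v) (hw : 0 < w)
      (h : y * v = x * u + z * w) : (0 < x → 0 < z → 0 < y) ∧ (0 < y → 0 < x ∨ 0 < z) := by
    constructor
    · intro hx hz
      exact pos_of_mul_pos_left (h ▸ by positivity) hv.le
    · intro hy
      by_contra! hxz
      nlinarith [mul_pos hy hv]
  have h₁ := no_alternation (x := det a b c) (y := det a b d) (z := det a c d) had hac hab
    (by unfold det; ring)
  have h₂ := no_alternation (x := det a b c) (y := det a b d) (z := det b c d) hbd hbc hab
    (by unfold det; ring)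
  have h₃ := no_alternation (x := det a b c) (y := det a c d) (z := det b c d) hcd hbc hac
    (by unfold det; ring)
  have h₄ := no_alternation (x := det a b d) (y := det a c d) (z := det b c d) hcd hbd had
    (by unfold det; ring)
  exact ⟨h₁.1, h₂.1, h₃.1, h₄.1, h₁.2, h₂.2, h₃.2, h₄.2⟩

/-- A point strictly to the right of a line is not in the convex hull of points weakly to
its left. -/
lemma notMem_convexHull_of_det {u w p : Pt} {T : Set Pt} (hp : det u w p < 0)
    (hT : ∀ x ∈ T, 0 ≤ det u w x) : p ∉ convexHull ℝ T := by
  have hconv : Convex ℝ {x : Pt | 0 ≤ det u w x} := by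
    intro x hx y hy s t hs ht hst
    have hs' : s = 1 - t := by linarith
    have key : det u w (s • x + t • y) = s * det u w x + t * det u w y := by
      subst hs'
      simp only [det, Prod.fst_add, Prod.snd_add, Prod.smul_fst, Prod.smul_snd, smul_eq_mul]
      ring
    simp only [Set.mem_ofPred_eq] at hx hy ⊢
    rw [key]
    positivity
  intro h
  exact absurd (convexHull_min hT hconv h) (not_le.mpr hp)

/-- All ordered triples of the sequence `a, b, c, d, e` are counterclockwise. -/
structure IsPentagon (a b c d e : Pt) : Prop where
  abc : 0 < det a b c
  abd : 0 < det a b d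
  abe : 0 < det a b e
  acd : 0 < det a c d
  ace : 0 < det a c e
  ade : 0 < det a d e
  bcd : 0 < det b c d
  bce : 0 < det b c e
  bde : 0 < det b d e
  cde : 0 < det c d e

lemma det_rotate (x y z : Pt) : det y z x = det x y z := by
  unfold det
  ring

lemma det_swap (x y z : Pt) : det z y x = -det x y z := by
  unfold det
  ring

lemma IsPentagon.rotate {a b c d e : Pt} (h : IsPentagon a b c d e) : IsPentagon b c d e a where
  abc := h.bcd
  abd := h.bce
  abe := (det_rotate a b c).symm ▸ h.abc
  acd := h.bde
  ace := (det_rotate a b d).symm ▸ h.abd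
  ade := (det_rotate a b e).symm ▸ h.abe
  bcd := h.cde
  bce := (det_rotate a c d).symm ▸ h.acd
  bde := (det_rotate a c e).symm ▸ h.ace
  cde := (det_rotate a d e).symm ▸ h.ade

lemma IsPentagon.notMem_convexHull {a b c d e : Pt} (h : IsPentagon a b c d e) {T : Set Pt}
    (hT : ∀ x ∈ T, x = b ∨ x = c ∨ x = d ∨ x = e) : a ∉ convexHull ℝ T := by
  refine notMem_convexHull_of_det (u := e) (w := b) ?_ fun x hx => ?_
  · linarith [det_swap a b e, h.abe]
  · rcases hT x hx with rfl | rfl | rfl | rfl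
    · exact (by unfold det; ring : det e x x = 0).ge
    · linarith [det_rotate e b x, h.bce]
    · linarith [det_rotate e b x, h.bde]
    · exact (by unfold det; ring : det x b x = 0).ge

lemma IsPentagon.card_eq {a b c d e : Pt} (h : IsPentagon a b c d e) :
    ({a, b, c, d, e} : Finset Pt).card = 5 := by
  have distinct {x y z : Pt} (h : 0 < det x y z) : x ≠ y ∧ x ≠ z ∧ y ≠ z := by
    refine ⟨?_, ?_, ?_⟩ <;> rintro rfl <;> simp [det, mul_comm] at h
  have := distinct h.abc
  have := distinct h.ade
  have := distinct h.bde
  have := distinct h.cde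
  simp [*]

lemma IsPentagon.convexPos {a b c d e : Pt} (h : IsPentagon a b c d e) :
    ConvexPos {a, b, c, d, e} := by
  intro p hp
  have hT (x : Pt) (hx : x ∈ (({a, b, c, d, e} : Finset Pt).erase p : Set Pt)) :
      x ≠ p ∧ (x = a ∨ x = b ∨ x = c ∨ x = d ∨ x = e) := by
    simpa [and_comm] using hx
  simp only [Finset.mem_insert, Finset.mem_singleton] at hp
  rcases hp with rfl | rfl | rfl | rfl | rfl
  · exact h.notMem_convexHull fun x hx => by have := hT x hx; tauto
  · exact h.rotate.notMem_convexHull fun x hx => by have := hT x hx; tauto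
  · exact h.rotate.rotate.notMem_convexHull fun x hx => by have := hT x hx; tauto
  · exact h.rotate.rotate.rotate.notMem_convexHull fun x hx => by have := hT x hx; tauto
  · exact h.rotate.rotate.rotate.rotate.notMem_convexHull fun x hx => by have := hT x hx; tauto

/-! ### Exhaustive search over sign assignments -/

/-- A sign pattern, given by the bit sets of the variables required to be true and of those
required to be false. -/
structure Pattern where
  pos : ℕ
  neg : ℕ

/-- The assignment `f` contains the pattern `c`. -/
def Pattern.Matches (c : Pattern) (f : ℕ → Prop) : Prop :=
  (∀ n, c.pos.testBit n → f n) ∧ ∀ n, c.neg.testBit n → ¬f n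

/-- The partial assignment with true variables `t` and false variables `s` contains the
pattern `c`. -/
def Pattern.occurs (t s : ℕ) (c : Pattern) : Bool :=
  Nat.beq (Nat.land c.pos t) c.pos && Nat.beq (Nat.land c.neg s) c.neg

/-- The pattern `c` involves the variable `v`. -/
def Pattern.mentions (v : ℕ) (c : Pattern) : Bool :=
  !Nat.beq (Nat.land (2 ^ v) (Nat.lor c.pos c.neg)) 0

/-- Search for an extension of a partial assignment, assigning the listed variables in turn and
checking after each assignment the patterns listed with the variable. Returns `true` when every
branch runs into a pattern. -/
def refutes : List (ℕ × List Pattern) → ℕ → ℕ → Bool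
  | [], _, _ => false
  | (v, cs) :: G, t, s =>
    (cs.any (Pattern.occurs (Nat.lor t (2 ^ v)) s) || refutes G (Nat.lor t (2 ^ v)) s) &&
    (cs.any (Pattern.occurs t (Nat.lor s (2 ^ v))) || refutes G t (Nat.lor s (2 ^ v)))

lemma Pattern.matches_of_occurs {f : ℕ → Prop} {t s : ℕ} {c : Pattern}
    (hf : Pattern.Matches ⟨t, s⟩ f) (hc : c.occurs t s = true) : c.Matches f := by
  have sub {m t : ℕ} (h : Nat.beq (Nat.land m t) m = true) (n : ℕ) (hn : m.testBit n) :
      t.testBit n := by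
    have h : m &&& t = m := Nat.eq_of_beq_eq_true h
    rw [← h, Nat.testBit_and, Bool.and_eq_true] at hn
    exact hn.2
  rw [Pattern.occurs, Bool.and_eq_true] at hc
  exact ⟨fun n hn => hf.1 n (sub hc.1 n hn), fun n hn => hf.2 n (sub hc.2 n hn)⟩

lemma exists_matches_of_refutes {f : ℕ → Prop} {G : List (ℕ × List Pattern)} {t s : ℕ}
    (hf : Pattern.Matches ⟨t, s⟩ f) (h : refutes G t s = true) :
    ∃ g ∈ G, ∃ c ∈ g.2, c.Matches f := by
  induction G generalizing t s with
  | nil => simp [refutes] at h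
  | cons g G ih =>
    obtain ⟨v, cs⟩ := g
    simp only [refutes, Bool.and_eq_true, Bool.or_eq_true, List.any_eq_true] at h
    have step {t s : ℕ} (hf : Pattern.Matches ⟨t, s⟩ f)
        (h : (∃ c ∈ cs, Pattern.occurs t s c = true) ∨ refutes G t s = true) :
        ∃ g ∈ (v, cs) :: G, ∃ c ∈ g.2, c.Matches f := by
      rcases h with ⟨c, hc, h⟩ | h
      · exact ⟨_, List.mem_cons_self, c, hc, Pattern.matches_of_occurs hf h⟩
      · obtain ⟨g, hg, h⟩ := ih hf h
        exact ⟨g, List.mem_cons_of_mem _ hg, h⟩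
    have insert_bit {m n : ℕ} (hn : (Nat.lor m (2 ^ v)).testBit n) : m.testBit n ∨ v = n := by
      change (m ||| 2 ^ v).testBit n at hn
      simpa [Nat.testBit_two_pow] using hn
    by_cases hv : f v
    · refine step (t := Nat.lor t (2 ^ v)) ⟨fun n hn => ?_, hf.2⟩ h.1
      rcases insert_bit hn with hn | rfl
      exacts [hf.1 n hn, hv]
    · refine step (s := Nat.lor s (2 ^ v)) ⟨hf.1, fun n hn => ?_⟩ h.2
      rcases insert_bit hn with hn | rfl
      exacts [hf.2 n hn, hv]

/-- Attach every pattern to the first variable of the list it involves, and prepend the result,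
in reverse order, to `G`. -/
def attach : List ℕ → List Pattern → List (ℕ × List Pattern) → List (ℕ × List Pattern)
  | [], _, G => G
  | v :: vs, cs, G =>
    attach vs (cs.filter fun c => !c.mentions v) ((v, cs.filter fun c => c.mentions v) :: G)

lemma mem_of_mem_attach {vs : List ℕ} {cs : List Pattern} {G : List (ℕ × List Pattern)}
    {g : ℕ × List Pattern} (hg : g ∈ attach vs cs G) {c : Pattern} (hc : c ∈ g.2) :
    c ∈ cs ∨ g ∈ G := by
  induction vs generalizing cs G with
  | nil => exact Or.inr hg
  | cons v vs ih =>
    rcases ih hg with h | h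
    · exact Or.inl (List.mem_of_mem_filter h)
    · rcases List.mem_cons.mp h with rfl | h
      · exact Or.inl (List.mem_of_mem_filter hc)
      · exact Or.inr h

/-- The variable encoding the orientation of the triple `a, b, c`. -/
def triple (a b c : ℕ) : ℕ := 64 * a + 8 * b + c

/-- The bit set of the variable `triple a b c`. -/
def tripleBit (a b c : ℕ) : ℕ := 2 ^ triple a b c

/-- Patterns on four points: a cup, or two sign changes. -/
def quadPatterns (a b c d : ℕ) : List Pattern :=
  [⟨tripleBit a b c ||| tripleBit b c d, 0⟩,
   ⟨tripleBit a b c ||| tripleBit a c d, tripleBit a b d⟩,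
   ⟨tripleBit a b d, tripleBit a b c ||| tripleBit a c d⟩,
   ⟨tripleBit a b c ||| tripleBit b c d, tripleBit a b d⟩,
   ⟨tripleBit a b d, tripleBit a b c ||| tripleBit b c d⟩,
   ⟨tripleBit a b c ||| tripleBit b c d, tripleBit a c d⟩,
   ⟨tripleBit a c d, tripleBit a b c ||| tripleBit b c d⟩,
   ⟨tripleBit a b d ||| tripleBit b c d, tripleBit a c d⟩,
   ⟨tripleBit a c d, tripleBit a b d ||| tripleBit b c d⟩]

/-- Patterns on five points: the convex pentagons with at most one vertex on the lower chain. -/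
def pentPatterns (a b c d e : ℕ) : List Pattern :=
  [⟨0, tripleBit a b c ||| tripleBit b c d ||| tripleBit c d e⟩,
   ⟨tripleBit a d e, tripleBit a b c ||| tripleBit b c e⟩,
   ⟨tripleBit a c e, tripleBit a b d ||| tripleBit b d e⟩,
   ⟨tripleBit a b e, tripleBit a c d ||| tripleBit c d e⟩]

/-- All patterns on the points `0, …, 7`. -/
def patterns : List Pattern :=
  (List.range 8).flatMap fun d => (List.range d).flatMap fun c =>
    (List.range c).flatMap fun b => (List.range b).flatMap fun a =>
      quadPatterns a b c d ++ (List.range a).flatMap fun z => pentPatterns z a b c d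

/-- The triples of `0, …, 7`, by decreasing width. -/
def triples : List ℕ :=
  (List.range 8).flatMap fun u => (List.range (u + 1)).flatMap fun i =>
    (List.range (6 - u)).map fun j => triple i (i + 1 + j) (i + 7 - u)

lemma refutes_patterns : refutes (attach triples patterns []) 0 0 = true := by
  decide +kernel

lemma exists_matches (f : ℕ → Prop) : ∃ c ∈ patterns, c.Matches f := by
  obtain ⟨g, hg, c, hc, h⟩ :=
    exists_matches_of_refutes (f := f) ⟨by simp, by simp⟩ refutes_patterns
  exact ⟨c, by simpa using mem_of_mem_attach hg hc, h⟩

/-! ### From patterns to pentagons -/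

section Propositional

variable {abc abd abe acd ace ade bcd bce bde cde : Prop}

/-- Signs in a five-point cap. -/
lemma Signotope.cap
    (h₁ : Signotope abc abd acd bcd) (h₂ : Signotope abc abe ace bce)
    (h₃ : Signotope abd abe ade bde) (h₄ : Signotope acd ace ade cde)
    (h₅ : Signotope bcd bce bde cde) (nabc : ¬abc) (nbcd : ¬bcd) (ncde : ¬cde) :
    ¬abd ∧ ¬abe ∧ ¬acd ∧ ¬ace ∧ ¬ade ∧ ¬bce ∧ ¬bde := by
  cases h₁; cases h₂; cases h₃; cases h₄; cases h₅
  grind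

/-- Signs in a convex pentagon with `d` the only inner vertex of its lower chain. -/
lemma Signotope.lower_d
    (h₁ : Signotope abc abd acd bcd) (h₂ : Signotope abc abe ace bce)
    (h₃ : Signotope abd abe ade bde) (h₄ : Signotope acd ace ade cde)
    (h₅ : Signotope bcd bce bde cde) (ade : ade) (nabc : ¬abc) (nbce : ¬bce) :
    ¬abd ∧ ¬abe ∧ ¬acd ∧ ¬ace ∧ ¬bcd ∧ bde ∧ cde := by
  cases h₁; cases h₂; cases h₃; cases h₄; cases h₅
  grind

/-- Signs in a convex pentagon with `c` the only inner vertex of its lower chain. -/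
lemma Signotope.lower_c
    (h₁ : Signotope abc abd acd bcd) (h₂ : Signotope abc abe ace bce)
    (h₃ : Signotope abd abe ade bde) (h₄ : Signotope acd ace ade cde)
    (h₅ : Signotope bcd bce bde cde) (ace : ace) (nabd : ¬abd) (nbde : ¬bde) :
    ¬abc ∧ ¬abe ∧ acd ∧ ¬ade ∧ bcd ∧ bce ∧ ¬cde := by
  cases h₁; cases h₂; cases h₃; cases h₄; cases h₅
  grind

/-- Signs in a convex pentagon with `b` the only inner vertex of its lower chain. -/
lemma Signotope.lower_b
    (h₁ : Signotope abc abd acd bcd) (h₂ : Signotope abc abe ace bce)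
    (h₃ : Signotope abd abe ade bde) (h₄ : Signotope acd ace ade cde)
    (h₅ : Signotope bcd bce bde cde) (abe : abe) (nacd : ¬acd) (ncde : ¬cde) :
    abc ∧ abd ∧ ¬ace ∧ ¬ade ∧ ¬bcd ∧ ¬bce ∧ ¬bde := by
  cases h₁; cases h₂; cases h₃; cases h₄; cases h₅
  grind

end Propositional

lemma forall_testBit_or {f : ℕ → Prop} {a b : ℕ} :
    (∀ n, (a ||| b).testBit n → f n) ↔
      (∀ n, a.testBit n → f n) ∧ ∀ n, b.testBit n → f n := by
  simp [or_imp, forall_and]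

lemma forall_testBit_tripleBit {f : ℕ → Prop} {a b c : ℕ} :
    (∀ n, (tripleBit a b c).testBit n → f n) ↔ f (triple a b c) := by
  simp [tripleBit, Nat.testBit_two_pow]

/-- If eight points are in counterclockwise order around `o`, then some five of the nine points
form a pentagon. -/
lemma exists_isPentagon {o : Pt} {p : ℕ → Pt} {S : Finset Pt} (hoS : o ∈ S)
    (hpS : ∀ i < 8, p i ∈ S) (ho : ∀ i j, i < j → j < 8 → 0 < det o (p i) (p j))
    (hp : ∀ i j k, i < j → j < k → k < 8 → det (p i) (p j) (p k) ≠ 0) :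
    ∃ a b c d e, IsPentagon a b c d e ∧ a ∈ S ∧ b ∈ S ∧ c ∈ S ∧ d ∈ S ∧ e ∈ S := by
  obtain ⟨c, hc, hm⟩ :=
    exists_matches fun n => 0 < det (p (n / 64)) (p (n / 8 % 8)) (p (n % 8))
  have decode {i j k : ℕ} (hi : i < 8) (hj : j < 8) (hk : k < 8) :
      triple i j k / 64 = i ∧ triple i j k / 8 % 8 = j ∧ triple i j k % 8 = k := by
    unfold triple
    omega
  have neg {i j k : ℕ} (hij : i < j) (hjk : j < k) (hk : k < 8)
      (h : ¬0 < det (p i) (p j) (p k)) : 0 < det (p k) (p j) (p i) := by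
    rw [det_swap]
    exact neg_pos.mpr (lt_of_le_of_ne (not_lt.mp h) (hp i j k hij hjk hk))
  have rot {x y z : Pt} (h : 0 < det x y z) : 0 < det y z x := by rwa [det_rotate]
  have sgn {i j k l : ℕ} (hij : i < j) (hjk : j < k) (hkl : k < l) (hl : l < 8) :=
    signotope_of_det_pos (ho i j hij (by omega)) (ho i k (by omega) (by omega))
      (ho i l (by omega) hl) (ho j k hjk (by omega)) (ho j l (by omega) hl) (ho k l hkl hl)
  simp only [patterns, List.mem_flatMap, List.mem_range, List.mem_append] at hc
  obtain ⟨l, hl, k, lt_kl, j, lt_jk, i, lt_ij, hc⟩ := hc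
  have hk := lt_kl.trans hl
  have hj := lt_jk.trans hk
  have hi := lt_ij.trans hj
  have lt_ik := lt_ij.trans lt_jk
  have lt_jl := lt_jk.trans lt_kl
  have lt_il := lt_ij.trans lt_jl
  have hs := sgn lt_ij lt_jk lt_kl hl
  obtain hc | ⟨z, lt_zi, hc⟩ := hc
  · simp only [quadPatterns, List.mem_cons, List.not_mem_nil, or_false] at hc
    rcases hc with rfl | rfl | rfl | rfl | rfl | rfl | rfl | rfl | rfl <;>
    simp only [Pattern.Matches, forall_testBit_or, forall_testBit_tripleBit, decode, hi, hj, hk,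
      hl] at hm
    · obtain ⟨⟨hijk, hjkl⟩, -⟩ := hm
      exact ⟨o, p i, p j, p k, p l,
        ⟨ho i j lt_ij hj, ho i k lt_ik hk, ho i l lt_il hl, ho j k lt_jk hk, ho j l lt_jl hl,
          ho k l lt_kl hl, hijk,
          hs.abd_of_abc_bcd hijk hjkl, hs.acd_of_abc_bcd hijk hjkl, hjkl⟩,
        hoS, hpS i hi, hpS j hj, hpS k hk, hpS l hl⟩
    · exact (hm.2 (hs.abd_of_abc_acd hm.1.1 hm.1.2)).elim
    · exact (hs.abc_or_acd hm.1).elim hm.2.1 hm.2.2 |>.elim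
    · exact (hm.2 (hs.abd_of_abc_bcd hm.1.1 hm.1.2)).elim
    · exact (hs.abc_or_bcd_of_abd hm.1).elim hm.2.1 hm.2.2 |>.elim
    · exact (hm.2 (hs.acd_of_abc_bcd hm.1.1 hm.1.2)).elim
    · exact (hs.abc_or_bcd_of_acd hm.1).elim hm.2.1 hm.2.2 |>.elim
    · exact (hm.2 (hs.acd_of_abd_bcd hm.1.1 hm.1.2)).elim
    · exact (hs.abd_or_bcd hm.1).elim hm.2.1 hm.2.2 |>.elim
  · have hz := lt_zi.trans hi
    have lt_zj := lt_zi.trans lt_ij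
    have lt_zk := lt_zi.trans lt_ik
    have h₁ := sgn lt_zi lt_ij lt_jk hk
    have h₂ := sgn lt_zi lt_ij lt_jl hl
    have h₃ := sgn lt_zi lt_ik lt_kl hl
    have h₄ := sgn lt_zj lt_jk lt_kl hl
    simp only [pentPatterns, List.mem_cons, List.not_mem_nil, or_false] at hc
    rcases hc with rfl | rfl | rfl | rfl <;>
    simp only [Pattern.Matches, forall_testBit_or, forall_testBit_tripleBit, decode, hz, hi, hj,
      hk, hl] at hm
    · obtain ⟨-, ⟨hzij, hijk⟩, hjkl⟩ := hm
      obtain ⟨hzik, hzil, hzjk, hzjl, hzkl, hijl, hikl⟩ :=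
        Signotope.cap h₁ h₂ h₃ h₄ hs hzij hijk hjkl
      refine ⟨p l, p k, p j, p i, p z, ?_, hpS l hl, hpS k hk, hpS j hj, hpS i hi, hpS z hz⟩
      exact ⟨neg lt_jk lt_kl hl hjkl, neg lt_ik lt_kl hl hikl, neg lt_zk lt_kl hl hzkl,
        neg lt_ij lt_jl hl hijl, neg lt_zj lt_jl hl hzjl, neg lt_zi lt_il hl hzil,
        neg lt_ij lt_jk hk hijk, neg lt_zj lt_jk hk hzjk, neg lt_zi lt_ik hk hzik,
        neg lt_zi lt_ij hj hzij⟩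
    · obtain ⟨hzkl, hzij, hijl⟩ := hm
      obtain ⟨hzik, hzil, hzjk, hzjl, hijk, hikl, hjkl⟩ :=
        Signotope.lower_d h₁ h₂ h₃ h₄ hs hzkl hzij hijl
      refine ⟨p z, p k, p l, p j, p i, ?_, hpS z hz, hpS k hk, hpS l hl, hpS j hj, hpS i hi⟩
      exact ⟨hzkl, rot (rot (neg lt_zj lt_jk hk hzjk)), rot (rot (neg lt_zi lt_ik hk hzik)),
        rot (rot (neg lt_zj lt_jl hl hzjl)), rot (rot (neg lt_zi lt_il hl hzil)),
        rot (rot (neg lt_zi lt_ij hj hzij)), rot hjkl, rot hikl, neg lt_ij lt_jk hk hijk,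
        neg lt_ij lt_jl hl hijl⟩
    · obtain ⟨hzjl, hzik, hikl⟩ := hm
      obtain ⟨hzij, hzil, hzjk, hzkl, hijk, hijl, hjkl⟩ :=
        Signotope.lower_c h₁ h₂ h₃ h₄ hs hzjl hzik hikl
      refine ⟨p z, p j, p l, p k, p i, ?_, hpS z hz, hpS j hj, hpS l hl, hpS k hk, hpS i hi⟩
      exact ⟨hzjl, hzjk, rot (rot (neg lt_zi lt_ij hj hzij)), rot (rot (neg lt_zk lt_kl hl hzkl)),
        rot (rot (neg lt_zi lt_il hl hzil)), rot (rot (neg lt_zi lt_ik hk hzik)),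
        rot (rot (neg lt_jk lt_kl hl hjkl)), rot hijl, rot hijk, neg lt_ik lt_kl hl hikl⟩
    · obtain ⟨hzil, hzjk, hjkl⟩ := hm
      obtain ⟨hzij, hzik, hzjl, hzkl, hijk, hijl, hikl⟩ :=
        Signotope.lower_b h₁ h₂ h₃ h₄ hs hzil hzjk hjkl
      refine ⟨p z, p i, p l, p k, p j, ?_, hpS z hz, hpS i hi, hpS l hl, hpS k hk, hpS j hj⟩
      exact ⟨hzil, hzik, hzij, rot (rot (neg lt_zk lt_kl hl hzkl)),
        rot (rot (neg lt_zj lt_jl hl hzjl)), rot (rot (neg lt_zj lt_jk hk hzjk)),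
        rot (rot (neg lt_ik lt_kl hl hikl)), rot (rot (neg lt_ij lt_jl hl hijl)),
        rot (rot (neg lt_ij lt_jk hk hijk)), neg lt_jk lt_kl hl hjkl⟩

/-! ### Sorting points around an extreme point -/

lemma collinear_of_det_eq_zero {x y z : Pt} (hxy : x ≠ y) (h : det x y z = 0) :
    Collinear ℝ ({x, y, z} : Set Pt) := by
  rw [collinear_iff_of_mem (p₀ := x) (by simp)]
  refine ⟨y - x, ?_⟩
  simp only [Set.mem_insert_iff, Set.mem_singleton_iff, forall_eq_or_imp, forall_eq]
  refine ⟨⟨0, by simp⟩, ⟨1, by simp⟩, ?_⟩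
  unfold det at h
  by_cases h1 : y.1 - x.1 = 0
  · have h2 : y.2 - x.2 ≠ 0 := fun h2 => hxy (Prod.ext (by linarith) (by linarith))
    refine ⟨(z.2 - x.2) / (y.2 - x.2), Prod.ext ?_ ?_⟩
    · simp only [vadd_eq_add, Prod.fst_add, Prod.smul_fst, Prod.fst_sub, smul_eq_mul]
      field_simp
      linarith
    · simp only [vadd_eq_add, Prod.snd_add, Prod.smul_snd, Prod.snd_sub, smul_eq_mul]
      field_simp
      linarith
  · refine ⟨(z.1 - x.1) / (y.1 - x.1), Prod.ext ?_ ?_⟩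
    · simp only [vadd_eq_add, Prod.fst_add, Prod.smul_fst, Prod.fst_sub, smul_eq_mul]
      field_simp
      linarith
    · simp only [vadd_eq_add, Prod.snd_add, Prod.smul_snd, Prod.snd_sub, smul_eq_mul]
      field_simp
      linarith

/-- Points lexicographically above `o`, no two of them collinear with `o`, can be listed in
counterclockwise order around `o`. -/
lemma exists_ccw_enumeration {o : Pt} {S : Finset Pt} (hS : ∀ x ∈ S, toLex o < toLex x)
    (hdet : ∀ x ∈ S, ∀ y ∈ S, x ≠ y → det o x y ≠ 0) :
    ∃ p : ℕ → Pt, (∀ i < S.card, p i ∈ S) ∧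
      ∀ i j, i < j → j < S.card → 0 < det o (p i) (p j) := by
  let slope (x : Pt) : WithTop ℝ :=
    if x.1 = o.1 then ⊤ else (((x.2 - o.2) / (x.1 - o.1) : ℝ) : WithTop ℝ)
  have lex {x : Pt} (hx : x ∈ S) : o.1 < x.1 ∨ o.1 = x.1 ∧ o.2 < x.2 := by
    simpa [Prod.Lex.toLex_lt_toLex] using hS x hx
  have slope_lt {x y : Pt} (hx : x ∈ S) (hy : y ∈ S) (h : slope x < slope y) :
      0 < det o x y := by
    have hx1 : x.1 ≠ o.1 := fun h1 => by simp [slope, h1] at h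
    have hx' : 0 < x.1 - o.1 := by
      rcases lex hx with h1 | ⟨h1, -⟩
      exacts [sub_pos.mpr h1, absurd h1.symm hx1]
    unfold det
    by_cases hy1 : y.1 = o.1
    · have hy' : 0 < y.2 - o.2 := by
        rcases lex hy with h1 | ⟨-, h1⟩
        exacts [absurd hy1 h1.ne', sub_pos.mpr h1]
      rw [hy1, sub_self, mul_zero, sub_zero]
      positivity
    · have hy' : 0 < y.1 - o.1 := by
        rcases lex hy with h1 | ⟨h1, -⟩
        exacts [sub_pos.mpr h1, absurd h1.symm hy1]
      simp only [slope, hx1, hy1, if_false, WithTop.coe_lt_coe] at h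
      rw [div_lt_div_iff₀ hx' hy'] at h
      linarith
  have slope_inj : Set.InjOn slope S := by
    intro x hx y hy h
    by_contra hxy
    apply hdet x hx y hy hxy
    unfold det
    by_cases hx1 : x.1 = o.1 <;> by_cases hy1 : y.1 = o.1
    · simp [hx1, hy1]
    · simp [slope, hx1, hy1] at h
    · simp [slope, hx1, hy1] at h
    · simp only [slope, hx1, hy1, if_false, WithTop.coe_inj] at h
      rw [div_eq_div_iff (sub_ne_zero.mpr hx1) (sub_ne_zero.mpr hy1)] at h
      linarith
  let e := (S.image slope).orderEmbOfFin (Finset.card_image_of_injOn slope_inj)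
  have he (i : Fin S.card) : ∃ x ∈ S, slope x = e i :=
    Finset.mem_image.mp (Finset.orderEmbOfFin_mem _ _ i)
  choose q hqS hq using he
  refine ⟨fun i => if h : i < S.card then q ⟨i, h⟩ else o, fun i hi => ?_, fun i j hij hj => ?_⟩
  · simp only [hi, dif_pos, hqS]
  · simp only [hij.trans hj, hj, dif_pos]
    refine slope_lt (hqS _) (hqS _) ?_
    rw [hq, hq]
    exact e.strictMono hij

/-- Erdős–Szekeres: any 9 points in general position contain 5 points in convex position. -/
theorem stmt1 (P : Finset Pt) (hcard : P.card = 9) (hgp : GenPos P) :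
    ∃ Q ⊆ P, Q.card = 5 ∧ ConvexPos Q := by
  have det_ne {x y z : Pt} (hx : x ∈ P) (hy : y ∈ P) (hz : z ∈ P) (hxy : x ≠ y) (hxz : x ≠ z)
      (hyz : y ≠ z) : det x y z ≠ 0 :=
    fun h => hgp x hx y hy z hz hxy hxz hyz (collinear_of_det_eq_zero hxy h)
  obtain ⟨o, ho, hmin⟩ := P.exists_min_image toLex (Finset.card_pos.mp (by omega))
  have hcard' : (P.erase o).card = 8 := by rw [Finset.card_erase_of_mem ho, hcard]
  obtain ⟨p, hpP, hp⟩ := exists_ccw_enumeration (o := o) (S := P.erase o)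
    (fun x hx => lt_of_le_of_ne (hmin x (Finset.mem_of_mem_erase hx))
      fun h => Finset.ne_of_mem_erase hx (toLex.injective h).symm)
    (fun x hx y hy hxy => det_ne ho (Finset.mem_of_mem_erase hx) (Finset.mem_of_mem_erase hy)
      (Finset.ne_of_mem_erase hx).symm (Finset.ne_of_mem_erase hy).symm hxy)
  rw [hcard'] at hpP hp
  have hpP' (i : ℕ) (hi : i < 8) : p i ∈ P := Finset.mem_of_mem_erase (hpP i hi)
  have hne (i j : ℕ) (hij : i < j) (hj : j < 8) : p i ≠ p j := by
    intro h
    have := hp i j hij hj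
    rw [h] at this
    simp [det, mul_comm] at this
  have hdet (i j k : ℕ) (hij : i < j) (hjk : j < k) (hk : k < 8) : det (p i) (p j) (p k) ≠ 0 :=
    det_ne (hpP' i (by omega)) (hpP' j (by omega)) (hpP' k hk) (hne i j hij (by omega))
      (hne i k (by omega) hk) (hne j k hjk hk)
  obtain ⟨a, b, c, d, e, h, ha, hb, hc, hd, he⟩ := exists_isPentagon ho hpP' hp hdet
  refine ⟨{a, b, c, d, e}, ?_, h.card_eq, h.convexPos⟩
  simp [Finset.insert_subset_iff, ha, hb, hc, hd, he]
end
end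

section
/- Every planar point set in general position of size 9 whose convex layer structure is (4,3,2) — i.e., the convex hull has 4 vertices, the convex hull of the remaining 5 points has 3 vertices, and the remaining 2 points are interior to that triangle — contains an empty convex pentagon: 5 points in convex position whose convex hull contains none of the other 4 points in its interior. -/
open scoped Classical
noncomputable section

/-- The triple `(p, q, r)` is positively oriented. -/
def Ccw (p q r : Pt) : Prop := 0 < det p q r

theorem det_rotate_s6 (p q r : Pt) : det q r p = det p q r := by
  simp only [det]; ring

theorem det_swap_s6 (p q r : Pt) : det p r q = -det p q r := by
  simp only [det]; ring

/-- The determinants of the three triangles spanned by `d` and an edge of `abc` sum to that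
of `abc`. -/
theorem det_add_det_add_det (a b c d : Pt) :
    det a b d + det b c d + det c a d = det a b c := by
  simp only [det]; ring

namespace Ccw

variable {p q r : Pt}

theorem rotate (h : Ccw p q r) : Ccw q r p := by
  rwa [Ccw, det_rotate_s6]

theorem swap_iff : Ccw p r q ↔ det p q r < 0 := by
  rw [Ccw, det_swap_s6, neg_pos]

theorem ne_left (h : Ccw p q r) : p ≠ q := by
  rintro rfl
  simp [Ccw, det] at h

theorem ne_right (h : Ccw p q r) : p ≠ r :=
  h.rotate.rotate.ne_left.symm

theorem of_interior {a b c d : Pt} (h₁ : Ccw a b d) (h₂ : Ccw b c d) (h₃ : Ccw c a d) :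
    Ccw a b c := by
  simp only [Ccw] at *
  linarith [det_add_det_add_det a b c d]

/-- The three-term Grassmann–Plücker relation, read as a rule on orientations. -/
theorem of_plucker {t a b c d : Pt} (h₁ : Ccw t a b ∧ Ccw t c d ∨ Ccw t b a ∧ Ccw t d c)
    (h₂ : Ccw t a d ∧ Ccw t b c ∨ Ccw t d a ∧ Ccw t c b) (h₃ : Ccw t b d) : Ccw t a c := by
  have key : det t a c * det t b d = det t a b * det t c d + det t a d * det t b c := by
    simp only [det]; ring
  have pos : ∀ {u v w z : Pt}, Ccw t u v ∧ Ccw t w z ∨ Ccw t v u ∧ Ccw t z w →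
      0 < det t u v * det t w z := by
    rintro u v w z (⟨h, h'⟩ | ⟨h, h'⟩)
    · exact mul_pos h h'
    · exact mul_pos_of_neg_of_neg (swap_iff.1 h) (swap_iff.1 h')
  exact pos_of_mul_pos_left (key ▸ add_pos (pos h₁) (pos h₂)) (le_of_lt h₃)

/-- Transitivity of the order in which the ray from `t` through `u` sweeps the half-plane to its
left. -/
theorem trans {t u p q r : Pt} (hp : Ccw t u p) (hq : Ccw t u q) (hr : Ccw t u r)
    (hpq : Ccw t p q) (hqr : Ccw t q r) : Ccw t p r :=
  of_plucker (.inr ⟨hp, hqr⟩) (.inl ⟨hpq, hr⟩) hq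

theorem asymm (h : Ccw p q r) (h' : Ccw p r q) : False :=
  lt_asymm h (swap_iff.1 h')

end Ccw

theorem convex_setOf_det_nonneg (u w : Pt) : Convex ℝ {x | 0 ≤ det u w x} := by
  intro x hx y hy s t hs ht hst
  have : det u w (s • x + t • y) = s * det u w x + t * det u w y := by
    obtain rfl : s = 1 - t := by linarith
    simp only [det, Prod.fst_add, Prod.snd_add, Prod.smul_fst, Prod.smul_snd, smul_eq_mul]
    ring
  simp only [Set.mem_ofPred_eq] at *
  rw [this]
  positivity

theorem det_nonneg_of_mem_convexHull {u w x : Pt} {T : Set Pt} (hx : x ∈ convexHull ℝ T)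
    (hT : ∀ v ∈ T, 0 ≤ det u w v) : 0 ≤ det u w x :=
  convexHull_min hT (convex_setOf_det_nonneg u w) hx

/-- A point strictly to the left of the three edges of `abc` lies in the triangle. -/
theorem mem_convexHull_of_ccw {a b c x : Pt} (h₁ : Ccw a b x) (h₂ : Ccw b c x) (h₃ : Ccw c a x) :
    x ∈ convexHull ℝ ({a, b, c} : Set Pt) := by
  have hD : 0 < det a b c := h₁.of_interior h₂ h₃
  have hsum := det_add_det_add_det a b c x
  simp only [Ccw] at *
  refine mem_convexHull_of_exists_fintype
    ![det b c x / det a b c, det c a x / det a b c, det a b x / det a b c] ![a, b, c] ?_ ?_ ?_ ?_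
  · intro i; fin_cases i <;> simp <;> positivity
  · simp [Fin.sum_univ_three]; field_simp; linarith
  · intro i; fin_cases i <;> simp
  · simp only [Fin.sum_univ_three]
    simp
    ext
    · simp; field_simp; simp only [det]; ring
    · simp; field_simp; simp only [det]; ring

theorem ccw_or_ccw_of_genPos {P : Finset Pt} (hP : GenPos P) {x y z : Pt} (hx : x ∈ P)
    (hy : y ∈ P) (hz : z ∈ P) (hxy : x ≠ y) (hxz : x ≠ z) (hyz : y ≠ z) :
    Ccw x y z ∨ Ccw x z y := by
  rw [Ccw.swap_iff, Ccw, or_comm]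
  refine lt_or_gt_of_ne fun h => hP x hx y hy z hz hxy hxz hyz ?_
  rw [collinear_iff_of_mem (p₀ := x) (by simp)]
  refine ⟨y - x, ?_⟩
  simp only [Set.mem_insert_iff, Set.mem_singleton_iff, forall_eq_or_imp, forall_eq, vadd_eq_add]
  refine ⟨⟨0, by simp⟩, ⟨1, by simp⟩, ?_⟩
  simp only [det] at h
  by_cases h1 : y.1 - x.1 = 0
  · have h2 : y.2 - x.2 ≠ 0 := fun h2 => hxy (Prod.ext (by linarith) (by linarith))
    refine ⟨(z.2 - x.2) / (y.2 - x.2), Prod.ext ?_ ?_⟩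
    · have : z.1 - x.1 = 0 := by
        rw [h1] at h
        have : (y.2 - x.2) * (z.1 - x.1) = 0 := by linarith
        exact (mul_eq_zero.1 this).resolve_left h2
      simp [h1]; linarith
    · simp; field_simp; ring
  · refine ⟨(z.1 - x.1) / (y.1 - x.1), Prod.ext ?_ ?_⟩
    · simp; field_simp; ring
    · simp; field_simp; linarith

/-- The finite case of the Krein–Milman theorem. -/
theorem convexHull_hullVerts (S : Finset Pt) :
    convexHull ℝ (hullVerts S : Set Pt) = convexHull ℝ (S : Set Pt) := by
  refine (convexHull_mono (Finset.coe_subset.2 (Finset.filter_subset _ _))).antisymm ?_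
  have hsub : (convexHull ℝ (S : Set Pt)).extremePoints ℝ ⊆ hullVerts S := by
    intro x hx
    refine Finset.mem_coe.2 (Finset.mem_filter.2 ⟨extremePoints_convexHull_subset hx, fun h => ?_⟩)
    rw [(convex_convexHull ℝ _).mem_extremePoints_iff_mem_sdiff_convexHull_sdiff] at hx
    refine hx.2 (convexHull_mono ?_ h)
    rw [Finset.coe_erase]
    exact Set.sdiff_subset_sdiff_left (subset_convexHull ℝ _)
  rw [← closure_convexHull_extremePoints (S.finite_toSet.isCompact_convexHull ℝ)
    (convex_convexHull ℝ _)]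
  exact closure_minimal (convexHull_mono hsub)
    ((hullVerts S).finite_toSet.isClosed_convexHull ℝ)

theorem convexPos_hullVerts (S : Finset Pt) : ConvexPos (hullVerts S) := fun p hp h =>
  (Finset.mem_filter.1 hp).2 <| convexHull_mono
    (Finset.coe_subset.2 (Finset.erase_subset_erase p (Finset.filter_subset _ _))) h

theorem notMem_convexHull_of_ccw {i j u : Pt} {T : Set Pt} (hT : ∀ k ∈ T, 0 ≤ det i j k)
    (hu : Ccw j i u) : u ∉ convexHull ℝ T := fun h => by
  have h₁ := det_nonneg_of_mem_convexHull h hT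
  exact (Ccw.swap_iff.1 hu.rotate).not_ge h₁

/-- `u` is a vertex of the counterclockwise pentagon `vwxyz` or lies to the right of an edge. -/
@[simp]
def OffPentagon (v w x y z u : Pt) : Prop :=
  u ∈ ({v, w, x, y, z} : Finset Pt) ∨
    Ccw w v u ∨ Ccw x w u ∨ Ccw y x u ∨ Ccw z y u ∨ Ccw v z u

/-- Five points in counterclockwise convex position form an empty convex pentagon of `P` as soon
as no other point of `P` lies inside. -/
theorem emptyConvexPentagon_of_ccw {P : Finset Pt} {v w x y z : Pt} (hv : v ∈ P) (hw : w ∈ P)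
    (hx : x ∈ P) (hy : y ∈ P) (hz : z ∈ P) (hvwx : Ccw v w x) (hvwy : Ccw v w y)
    (hvwz : Ccw v w z) (hvxy : Ccw v x y) (hvxz : Ccw v x z) (hvyz : Ccw v y z)
    (hwxy : Ccw w x y) (hwxz : Ccw w x z) (hwyz : Ccw w y z) (hxyz : Ccw x y z)
    (hout : ∀ u ∈ P, OffPentagon v w x y z u) : EmptyConvexPentagon P {v, w, x, y, z} := by
  have nonneg : ∀ {i j k : Pt}, Ccw i j k → 0 ≤ det i j k := le_of_lt
  have left : ∀ i j : Pt, det i j i = 0 := fun i j => by simp [det]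
  have right : ∀ i j : Pt, det i j j = 0 := fun i j => by simp only [det]; ring
  refine ⟨by simp [Finset.insert_subset_iff, *], ?_, ?_, fun u hu huS hint => ?_⟩
  · simp [Finset.card_insert_of_notMem, hvwx.ne_left, hvwx.ne_right, hvwy.ne_right,
      hvwz.ne_right, hwxy.ne_left, hwxy.ne_right, hwxz.ne_right, hxyz.ne_left, hxyz.ne_right,
      hxyz.rotate.ne_left]
  · intro u hu
    simp only [Finset.mem_insert, Finset.mem_singleton] at hu
    rcases hu with rfl | rfl | rfl | rfl | rfl
    · refine notMem_convexHull_of_ccw (i := z) (j := w) ?_ hvwz.rotate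
      simp +contextual [left, right, nonneg hwxz.rotate.rotate, nonneg hwyz.rotate.rotate]
    · refine notMem_convexHull_of_ccw (i := v) (j := x) ?_ hvwx.rotate.rotate
      simp +contextual [left, right, nonneg hvxy, nonneg hvxz]
    · refine notMem_convexHull_of_ccw (i := w) (j := y) ?_ hwxy.rotate.rotate
      simp +contextual [left, right, nonneg hvwy.rotate, nonneg hwyz]
    · refine notMem_convexHull_of_ccw (i := x) (j := z) ?_ hxyz.rotate.rotate
      simp +contextual [left, right, nonneg hvxz.rotate, nonneg hwxz.rotate]
    · refine notMem_convexHull_of_ccw (i := y) (j := v) ?_ hvyz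
      simp +contextual [left, right, nonneg hvwy.rotate.rotate, nonneg hvxy.rotate.rotate]
  · revert hint
    refine mt (fun h => interior_subset h) ?_
    rcases (hout u hu).resolve_left huS with h | h | h | h | h <;>
    · refine notMem_convexHull_of_ccw ?_ h
      simp [left, right, nonneg, hvwx, hvwy, hvwz, hwxy, hwxz, hxyz, hvwx.rotate, hwxy.rotate,
        hvxy.rotate, hxyz.rotate, hvyz.rotate, hwyz.rotate, hvwz.rotate.rotate,
        hvxz.rotate.rotate, hvyz.rotate.rotate]

/-- `x` lies inside the counterclockwise triangle `abc`. -/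
def InTriangle (a b c x : Pt) : Prop := Ccw a b x ∧ Ccw b c x ∧ Ccw c a x

/-- `x` lies inside the counterclockwise convex quadrilateral `pqrs`. -/
def InQuad (p q r s x : Pt) : Prop := Ccw p q x ∧ Ccw q r x ∧ Ccw r s x ∧ Ccw s p x

/-- A labelling of `P` by a convex quadrilateral `pqrs` around a triangle `abc` around `d, e`. -/
structure IsLayered (P : Finset Pt) (a b c d e p q r s : Pt) : Prop where
  mem_iff : ∀ x, x ∈ P ↔ x = a ∨ x = b ∨ x = c ∨ x = d ∨ x = e ∨ x = p ∨ x = q ∨ x = r ∨ x = s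
  genPos : GenPos P
  triangle : Ccw a b c
  triangle_d : InTriangle a b c d
  triangle_e : InTriangle a b c e
  pqr : Ccw p q r
  qrs : Ccw q r s
  rsp : Ccw r s p
  spq : Ccw s p q
  quad_a : InQuad p q r s a
  quad_b : InQuad p q r s b
  quad_c : InQuad p q r s c
  quad_d : InQuad p q r s d
  quad_e : InQuad p q r s e

namespace IsLayered

variable {P : Finset Pt} {a b c d e p q r s : Pt}

theorem rotate_triangle (h : IsLayered P a b c d e p q r s) : IsLayered P b c a d e p q r s where
  __ := h
  mem_iff x := (h.mem_iff x).trans (by tauto)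
  triangle := h.triangle.rotate
  triangle_d := ⟨h.triangle_d.2.1, h.triangle_d.2.2, h.triangle_d.1⟩
  triangle_e := ⟨h.triangle_e.2.1, h.triangle_e.2.2, h.triangle_e.1⟩
  quad_a := h.quad_b
  quad_b := h.quad_c
  quad_c := h.quad_a

theorem swap_inner (h : IsLayered P a b c d e p q r s) : IsLayered P a b c e d p q r s where
  __ := h
  mem_iff x := (h.mem_iff x).trans (by tauto)
  triangle_d := h.triangle_e
  triangle_e := h.triangle_d
  quad_d := h.quad_e
  quad_e := h.quad_d

theorem rotate_quad (h : IsLayered P a b c d e p q r s) : IsLayered P a b c d e q r s p where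
  __ := h
  mem_iff x := (h.mem_iff x).trans (by tauto)
  pqr := h.qrs
  qrs := h.rsp
  rsp := h.spq
  spq := h.pqr
  quad_a := ⟨h.quad_a.2.1, h.quad_a.2.2.1, h.quad_a.2.2.2, h.quad_a.1⟩
  quad_b := ⟨h.quad_b.2.1, h.quad_b.2.2.1, h.quad_b.2.2.2, h.quad_b.1⟩
  quad_c := ⟨h.quad_c.2.1, h.quad_c.2.2.1, h.quad_c.2.2.2, h.quad_c.1⟩
  quad_d := ⟨h.quad_d.2.1, h.quad_d.2.2.1, h.quad_d.2.2.2, h.quad_d.1⟩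
  quad_e := ⟨h.quad_e.2.1, h.quad_e.2.2.1, h.quad_e.2.2.2, h.quad_e.1⟩

/-- The case where the line `de` separates `a` from `b` and `c`, and leaves the quadrilateral
through the edge `pq` on the side of `e`. -/
theorem exists_emptyConvexPentagon_of_ccw (h : IsLayered P a b c d e p q r s)
    (hdea : Ccw d e a) (hedb : Ccw e d b) (hedc : Ccw e d c) (hedp : Ccw e d p)
    (hdeq : Ccw d e q) : ∃ S, EmptyConvexPentagon P S := by
  by_contra hno
  obtain ⟨hmem, hgp, habc, ⟨habd, hbcd, hcad⟩, ⟨habe, hbce, hcae⟩, hpqr, hqrs, hrsp, hspq,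
    ⟨hpqa, hqra, hrsa, hspa⟩, ⟨hpqb, hqrb, hrsb, hspb⟩, ⟨hpqc, hqrc, hrsc, hspc⟩,
    ⟨hpqd, hqrd, hrsd, hspd⟩, ⟨hpqe, hqre, hrse, hspe⟩⟩ := h
  have hpent : ∀ {v w x y z : Pt}, v ∈ P → w ∈ P → x ∈ P → y ∈ P → z ∈ P → Ccw v w x →
      Ccw v w y → Ccw v w z → Ccw v x y → Ccw v x z → Ccw v y z → Ccw w x y → Ccw w x z →
      Ccw w y z → Ccw x y z → OffPentagon v w x y z a → OffPentagon v w x y z b →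
      OffPentagon v w x y z c → OffPentagon v w x y z d → OffPentagon v w x y z e →
      OffPentagon v w x y z p → OffPentagon v w x y z q → OffPentagon v w x y z r →
      OffPentagon v w x y z s → False := by
    intro v w x y z hv hw hx hy hz h₁ h₂ h₃ h₄ h₅ h₆ h₇ h₈ h₉ h₁₀ oa ob oc od oe op oq or os
    refine hno ⟨_, emptyConvexPentagon_of_ccw hv hw hx hy hz h₁ h₂ h₃ h₄ h₅ h₆ h₇ h₈ h₉ h₁₀
      fun u hu => ?_⟩
    rcases (hmem u).1 hu with rfl | rfl | rfl | rfl | rfl | rfl | rfl | rfl | rfl <;> assumption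
  have htot := @ccw_or_ccw_of_genPos P hgp
  obtain ⟨ha, hb, hc, hd, he, hp, hq, hr, hs⟩ : a ∈ P ∧ b ∈ P ∧ c ∈ P ∧ d ∈ P ∧ e ∈ P ∧ p ∈ P ∧
      q ∈ P ∧ r ∈ P ∧ s ∈ P := by simp [hmem]
  obtain hdes | hdse := htot hd he hs hdeq.ne_left hspd.rotate.rotate.ne_left
      hspe.rotate.rotate.ne_left
  · have heqs : Ccw e q s := Ccw.of_plucker (.inl ⟨hdeq.rotate, hspe.rotate.rotate⟩)
        (.inr ⟨hpqe.rotate.rotate, hdes.rotate⟩) hedp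
    have hder : Ccw d e r := (Ccw.of_plucker (.inr ⟨hqre.rotate.rotate, hdes.rotate⟩)
        (.inl ⟨hrse.rotate.rotate, hdeq.rotate⟩) heqs).rotate.rotate
    have hdqs : Ccw d q s := Ccw.of_plucker (.inr ⟨hpqd.rotate.rotate, hdes⟩)
        (.inr ⟨hdeq, hspd.rotate.rotate⟩) hedp.rotate
    have haeq : Ccw a e q := (htot ha he hq habe.ne_right hpqa.rotate.rotate.ne_right
        heqs.ne_left).resolve_right fun haqe => hpent hd he hq hr hs hdeq hder hdes
        hqrd.rotate.rotate hdqs hrsd.rotate.rotate hqre.rotate.rotate heqs hrse.rotate.rotate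
        hqrs (by simp [haqe.rotate]) (by simp [hedb]) (by simp [hedc]) (by simp) (by simp)
        (by simp [hedp]) (by simp) (by simp) (by simp)
    have hasd : Ccw a s d := (htot ha hs hd hspa.rotate.rotate.ne_left habd.ne_right
        hspd.ne_right).resolve_right fun hads => hpent hd he hq hr hs hdeq hder hdes
        hqrd.rotate.rotate hdqs hrsd.rotate.rotate hqre.rotate.rotate heqs hrse.rotate.rotate
        hqrs (by simp [hads.rotate]) (by simp [hedb]) (by simp [hedc]) (by simp) (by simp)
        (by simp [hedp]) (by simp) (by simp) (by simp)
    have hcqe : Ccw c q e := (Ccw.of_plucker (.inl ⟨hcae.rotate.rotate, hdeq.rotate⟩)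
        (.inr ⟨hedc, haeq.rotate⟩) hdea.rotate).rotate
    have hacq : Ccw a c q := (Ccw.of_plucker (.inl ⟨haeq.rotate.rotate, hpqc.rotate⟩)
        (.inl ⟨hpqa.rotate, hcqe.rotate⟩) hpqe.rotate).rotate
    have hbds : Ccw b d s := (Ccw.of_plucker (.inr ⟨hdes, habd.rotate.rotate⟩)
        (.inr ⟨hasd.rotate.rotate, hedb.rotate⟩) hdea).rotate.rotate
    have hbes : Ccw b e s := (Ccw.of_plucker (.inr ⟨hspb, hdes.rotate.rotate⟩)
        (.inl ⟨hbds.rotate.rotate, hspe⟩) hspd).rotate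
    obtain haer | hare := htot ha he hr haeq.ne_left hqra.rotate.rotate.ne_right
        hder.rotate.ne_left
    · have hcre : Ccw c r e := (Ccw.of_plucker (.inl ⟨hcae.rotate.rotate, hder.rotate⟩)
          (.inr ⟨hedc, haer.rotate⟩) hdea.rotate).rotate
      have hacr : Ccw a c r := (Ccw.of_plucker (.inl ⟨haer.rotate.rotate, hqrc.rotate⟩)
          (.inl ⟨hqra.rotate, hcre.rotate⟩) hqre.rotate).rotate
      exact hpent ha he hc hq hr hcae.rotate haeq haer hacq hacr hqra.rotate.rotate
          hcqe.rotate.rotate hcre.rotate.rotate hqre.rotate.rotate hqrc.rotate.rotate (by simp)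
          (by simp [hbce.rotate]) (by simp) (by simp [hdea.rotate]) (by simp)
          (by simp [hpqc.rotate]) (by simp) (by simp) (by simp [hrsa.rotate.rotate])
    · have hber : Ccw b e r := (Ccw.of_plucker (.inr ⟨hare.rotate.rotate, hedb⟩)
          (.inl ⟨hder.rotate, habe.rotate.rotate⟩) hdea.rotate).rotate.rotate
      have hase : Ccw a s e := (Ccw.of_plucker (.inl ⟨hare.rotate.rotate, hbes.rotate⟩)
          (.inl ⟨habe.rotate.rotate, hrse.rotate.rotate⟩) hber.rotate).rotate
      have hard : Ccw a r d := (Ccw.of_plucker (.inl ⟨hder.rotate.rotate, hqra.rotate⟩)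
          (.inl ⟨hqrd.rotate, hare.rotate⟩) hqre.rotate).rotate.rotate
      exact hpent ha hr hs hd he hrsa.rotate.rotate hard hare hasd hase hdea.rotate.rotate hrsd
          hrse hder.rotate.rotate hdes.rotate.rotate (by simp) (by simp [hedb]) (by simp [hedc])
          (by simp) (by simp) (by simp [hedp]) (by simp [haeq]) (by simp) (by simp)
  · obtain hces | hcse := htot hc he hs hcae.ne_right hspc.rotate.rotate.ne_left
        hspe.rotate.rotate.ne_left
    · have hcds : Ccw c d s := (Ccw.of_plucker (.inr ⟨hspc, hdse.rotate⟩)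
          (.inl ⟨hces.rotate.rotate, hspd⟩) hspe).rotate
      obtain hbds | hbsd := htot hb hd hs hbcd.ne_right hspb.rotate.rotate.ne_left hdse.ne_left
      · have hasd : Ccw a s d := (Ccw.of_plucker (.inl ⟨habd.rotate.rotate, hcds.rotate⟩)
            (.inr ⟨hcad.rotate.rotate, hbds.rotate⟩) hbcd.rotate.rotate).rotate
        have hasb : Ccw a s b := (Ccw.of_plucker (.inr ⟨hspb, hasd.rotate⟩)
            (.inl ⟨hbds.rotate.rotate, hspa⟩) hspd).rotate.rotate
        have hase : Ccw a s e := (Ccw.of_plucker (.inr ⟨hspe, hasd.rotate⟩)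
            (.inl ⟨hdse.rotate, hspa⟩) hspd).rotate.rotate
        obtain hadr | hard := htot ha hd hr habd.ne_right hqra.rotate.rotate.ne_right
            hqrd.rotate.rotate.ne_right
        · have hder : Ccw d e r := Ccw.of_plucker (.inl ⟨hdea, hrsd.rotate.rotate⟩)
              (.inr ⟨hdse, hadr.rotate⟩) hasd.rotate.rotate
          have haer : Ccw a e r := Ccw.of_plucker (.inr ⟨hase, hadr⟩)
              (.inr ⟨hdea.rotate.rotate, hrsa.rotate.rotate⟩) hasd
          have haeq : Ccw a e q := (Ccw.of_plucker (.inl ⟨hqre.rotate.rotate, hdea.rotate⟩)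
              (.inl ⟨hdeq.rotate, haer.rotate⟩) hder.rotate).rotate.rotate
          have hadq : Ccw a d q := (Ccw.of_plucker (.inr ⟨hdeq, hadr.rotate⟩)
              (.inl ⟨hqrd.rotate.rotate, hdea⟩) hder).rotate.rotate
          exact hpent ha hd he hq hr hdea.rotate.rotate hadq hadr haeq haer hqra.rotate.rotate
              hdeq hder hqrd.rotate.rotate hqre.rotate.rotate (by simp) (by simp [hedb])
              (by simp [hedc]) (by simp) (by simp) (by simp [hedp]) (by simp) (by simp)
              (by simp [hasd.rotate.rotate])
        · have hbdr : Ccw b d r := (Ccw.of_plucker (.inr ⟨hard.rotate.rotate, hbds.rotate⟩)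
              (.inl ⟨hrsd.rotate.rotate, habd.rotate.rotate⟩) hasd.rotate.rotate).rotate.rotate
          have harb : Ccw a r b := Ccw.of_plucker (.inl ⟨hrsa.rotate.rotate, habd⟩)
              (.inl ⟨hard, hasb⟩) hasd
          exact hpent ha hr hs hb hd hrsa.rotate.rotate harb hard hasb hasd habd hrsb hrsd
              hbdr.rotate.rotate hbds.rotate.rotate (by simp) (by simp) (by simp [hcad.rotate])
              (by simp) (by simp [hedb.rotate]) (by simp [hspb.rotate.rotate])
              (by simp [hqra.rotate]) (by simp) (by simp)
      · have hbsc : Ccw b s c := (Ccw.of_plucker (.inr ⟨hspc, hbsd.rotate⟩)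
            (.inl ⟨hcds.rotate.rotate, hspb⟩) hspd).rotate.rotate
        have hbse : Ccw b s e := (Ccw.of_plucker (.inr ⟨hspe, hbsd.rotate⟩)
            (.inl ⟨hdse.rotate, hspb⟩) hspd).rotate.rotate
        exact hpent hb hs hc he hd hbsc hbse hbsd hbce hbcd hedb.rotate.rotate hces.rotate.rotate
            hcds.rotate.rotate hdse.rotate hedc.rotate.rotate (by simp [hdea]) (by simp)
            (by simp) (by simp) (by simp) (by simp [hspc.rotate.rotate]) (by simp [hdeq])
            (by simp [hrsb.rotate]) (by simp)
    · have haes : Ccw a e s := (Ccw.of_plucker (.inr ⟨hdse.rotate.rotate, hcae.rotate.rotate⟩)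
          (.inr ⟨hcse.rotate.rotate, hdea.rotate⟩) hedc).rotate.rotate
      have hacs : Ccw a c s := (Ccw.of_plucker (.inr ⟨hspa, hcse.rotate⟩)
          (.inl ⟨haes.rotate.rotate, hspc⟩) hspe).rotate
      have hcpe : Ccw c p e := (Ccw.of_plucker (.inr ⟨hedc, hspe.rotate.rotate⟩)
          (.inl ⟨hcse.rotate.rotate, hedp⟩) hdse.rotate.rotate).rotate
      have haep : Ccw a e p := (Ccw.of_plucker (.inr ⟨hedp, haes.rotate⟩)
          (.inr ⟨hspe.rotate.rotate, hdea.rotate⟩) hdse.rotate.rotate).rotate.rotate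
      have hacp : Ccw a c p := Ccw.of_plucker (.inr ⟨hcae.rotate, hspa.rotate.rotate⟩)
          (.inl ⟨hacs, haep⟩) haes
      exact hpent ha he hc hs hp hcae.rotate haes haep hacs hacp hspa.rotate.rotate
          hcse.rotate.rotate hcpe.rotate.rotate hspe.rotate.rotate hspc.rotate.rotate (by simp)
          (by simp [hbce.rotate]) (by simp) (by simp [hdea.rotate]) (by simp) (by simp)
          (by simp [hpqa.rotate.rotate]) (by simp [hrsc.rotate]) (by simp)

theorem exists_emptyConvexPentagon_of_separates (h : IsLayered P a b c d e p q r s)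
    (hdea : Ccw d e a) (hedb : Ccw e d b) (hedc : Ccw e d c) :
    ∃ S, EmptyConvexPentagon P S := by
  have side : ∀ x ∈ P, d ≠ x → e ≠ x → Ccw d e x ∨ Ccw e d x := fun x hx hdx hex =>
    (ccw_or_ccw_of_genPos h.genPos (by simp [h.mem_iff]) (by simp [h.mem_iff]) hx hdea.ne_left
      hdx hex).imp_right fun h => h.rotate.rotate
  obtain ⟨hpd, hqd, hrd, hsd⟩ := h.quad_d
  obtain ⟨hpe, hqe, hre, hse⟩ := h.quad_e
  have sp := side p (by simp [h.mem_iff]) hpd.ne_right.symm hpe.ne_right.symm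
  have sq := side q (by simp [h.mem_iff]) hqd.ne_right.symm hqe.ne_right.symm
  have sr := side r (by simp [h.mem_iff]) hrd.ne_right.symm hre.ne_right.symm
  have ss := side s (by simp [h.mem_iff]) hsd.ne_right.symm hse.ne_right.symm
  have not_left : ¬(Ccw d e p ∧ Ccw d e q ∧ Ccw d e r ∧ Ccw d e s) := fun ⟨hp, hq, hr, hs⟩ =>
    (hp.trans hr hs (hp.trans hq hr hpd.rotate.rotate hqd.rotate.rotate)
      hrd.rotate.rotate).asymm hsd.rotate.rotate
  have not_right : ¬(Ccw e d p ∧ Ccw e d q ∧ Ccw e d r ∧ Ccw e d s) := fun ⟨hp, hq, hr, hs⟩ =>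
    (hp.trans hr hs (hp.trans hq hr hpe.rotate.rotate hqe.rotate.rotate)
      hre.rotate.rotate).asymm hse.rotate.rotate
  have exit : Ccw e d p ∧ Ccw d e q ∨ Ccw e d q ∧ Ccw d e r ∨ Ccw e d r ∧ Ccw d e s ∨
      Ccw e d s ∧ Ccw d e p := by
    tauto
  rcases exit with ⟨h₁, h₂⟩ | ⟨h₁, h₂⟩ | ⟨h₁, h₂⟩ | ⟨h₁, h₂⟩
  · exact h.exists_emptyConvexPentagon_of_ccw hdea hedb hedc h₁ h₂
  · exact h.rotate_quad.exists_emptyConvexPentagon_of_ccw hdea hedb hedc h₁ h₂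
  · exact h.rotate_quad.rotate_quad.exists_emptyConvexPentagon_of_ccw hdea hedb hedc h₁ h₂
  · exact h.rotate_quad.rotate_quad.rotate_quad.exists_emptyConvexPentagon_of_ccw hdea hedb hedc
      h₁ h₂

theorem exists_emptyConvexPentagon (h : IsLayered P a b c d e p q r s) (hde : d ≠ e) :
    ∃ S, EmptyConvexPentagon P S := by
  have side : ∀ x ∈ P, d ≠ x → e ≠ x → Ccw d e x ∨ Ccw e d x := fun x hx hdx hex =>
    (ccw_or_ccw_of_genPos h.genPos (by simp [h.mem_iff]) (by simp [h.mem_iff]) hx hde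
      hdx hex).imp_right fun h => h.rotate.rotate
  obtain ⟨had, hbd, hcd⟩ := h.triangle_d
  obtain ⟨hae, hbe, hce⟩ := h.triangle_e
  have sa := side a (by simp [h.mem_iff]) had.ne_right.symm hae.ne_right.symm
  have sb := side b (by simp [h.mem_iff]) hbd.ne_right.symm hbe.ne_right.symm
  have sc := side c (by simp [h.mem_iff]) hcd.ne_right.symm hce.ne_right.symm
  rcases sa with ha | ha <;> rcases sb with hb | hb <;> rcases sc with hc | hc
  · exact ((ha.trans hb hc had.rotate.rotate hbd.rotate.rotate).asymm hcd.rotate.rotate).elim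
  · exact h.rotate_triangle.rotate_triangle.swap_inner.exists_emptyConvexPentagon_of_separates
      hc ha hb
  · exact h.rotate_triangle.swap_inner.exists_emptyConvexPentagon_of_separates hb hc ha
  · exact h.exists_emptyConvexPentagon_of_separates ha hb hc
  · exact h.swap_inner.exists_emptyConvexPentagon_of_separates ha hb hc
  · exact h.rotate_triangle.exists_emptyConvexPentagon_of_separates hb hc ha
  · exact h.rotate_triangle.rotate_triangle.exists_emptyConvexPentagon_of_separates hc ha hb
  · exact ((ha.trans hb hc hae.rotate.rotate hbe.rotate.rotate).asymm hce.rotate.rotate).elim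

end IsLayered

/-- Four points in convex position can be labelled in counterclockwise order. -/
theorem exists_ccw_quad {Q : Finset Pt} (hcard : Q.card = 4) (hgp : GenPos Q)
    (hconv : ConvexPos Q) :
    ∃ p q r s, Q = {p, q, r, s} ∧ Ccw p q r ∧ Ccw q r s ∧ Ccw r s p ∧ Ccw s p q := by
  have notMem : ∀ {p q r s : Pt}, Q = {p, q, r, s} → s ≠ p → s ≠ q → s ≠ r →
      ¬(Ccw p q s ∧ Ccw q r s ∧ Ccw r p s) := by
    rintro p q r s rfl hp hq hr ⟨h₁, h₂, h₃⟩
    refine hconv s (by simp) (convexHull_mono ?_ (mem_convexHull_of_ccw h₁ h₂ h₃))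
    simp [Set.insert_subset_iff, hp.symm, hq.symm, hr.symm]
  have of_ccw : ∀ {p q r s : Pt}, Q = {p, q, r, s} → s ≠ p → s ≠ q → s ≠ r → Ccw p q r →
      ∃ p q r s, Q = {p, q, r, s} ∧ Ccw p q r ∧ Ccw q r s ∧ Ccw r s p ∧ Ccw s p q := by
    intro p q r s hQ hp hq hr h
    have htot := @ccw_or_ccw_of_genPos Q hgp
    have hpQ : p ∈ Q := by simp [hQ]
    have hqQ : q ∈ Q := by simp [hQ]
    have hrQ : r ∈ Q := by simp [hQ]
    have hsQ : s ∈ Q := by simp [hQ]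
    have hpqsr : Q = {p, q, s, r} := by rw [hQ, Finset.pair_comm]
    rcases htot hpQ hqQ hsQ h.ne_left hp.symm hq.symm with h₁ | h₁ <;>
    rcases htot hqQ hrQ hsQ h.rotate.ne_left hq.symm hr.symm with h₂ | h₂ <;>
    rcases htot hrQ hpQ hsQ h.rotate.rotate.ne_left hr.symm hp.symm with h₃ | h₃
    · exact (notMem hQ hp hq hr ⟨h₁, h₂, h₃⟩).elim
    · exact ⟨p, q, r, s, hQ, h, h₂, h₃, h₁.rotate.rotate⟩
    · exact ⟨p, q, s, r, hpqsr, h₁, h₂, h₃.rotate.rotate, h.rotate.rotate⟩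
    · exact (notMem hpqsr h.ne_right.symm h.rotate.ne_left.symm hr.symm
        ⟨h, h₂, h₃.rotate⟩).elim
    · exact ⟨p, s, q, r, by rw [hpqsr, Finset.insert_comm q s], h₁, h₂.rotate.rotate, h.rotate,
        h₃⟩
    · exact (notMem (by rw [hQ]; ext; simp; tauto) h.ne_left h.ne_right hp.symm
        ⟨h.rotate, h₃, h₁.rotate⟩).elim
    · exact (notMem (by rw [hQ]; ext; simp; tauto) h.rotate.ne_left h.ne_left.symm hq.symm
        ⟨h.rotate.rotate, h₁, h₂.rotate⟩).elim
    · exact (h.asymm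
        (h₁.rotate.rotate.of_interior h₃.rotate.rotate h₂.rotate.rotate).rotate).elim
  obtain ⟨s, T, hsT, rfl, hT⟩ := Finset.card_eq_succ.1 hcard
  obtain ⟨p, q, r, hpq, hpr, hqr, rfl⟩ := Finset.card_eq_three.1 hT
  simp only [Finset.mem_insert, Finset.mem_singleton, not_or] at hsT
  obtain ⟨hp, hq, hr⟩ := hsT
  rcases ccw_or_ccw_of_genPos hgp (x := p) (y := q) (z := r) (by simp) (by simp) (by simp) hpq hpr
    hqr with h | h
  · exact of_ccw (by ext; simp; tauto) hp hq hr h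
  · exact of_ccw (by ext; simp; tauto) hp hr hq h

/-- Any 9-point set in general position with convex layer type (4,3,2) contains
an empty convex pentagon. -/
theorem stmt6 (P : Finset Pt) (hcard : P.card = 9) (hgp : GenPos P)
    (h1 : (hullVerts P).card = 4)
    (h2 : (hullVerts (P \ hullVerts P)).card = 3) :
    ∃ S, EmptyConvexPentagon P S := by
  have strict : ∀ {T : Finset Pt} {u w x : Pt}, T ⊆ P → u ∈ T → w ∈ T → u ≠ w → x ∈ P → x ∉ T →
      x ∈ convexHull ℝ (T : Set Pt) → (∀ v ∈ T, 0 ≤ det u w v) → Ccw u w x := by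
    intro T u w x hT hu hw huw hx hxT hxc h
    refine (ccw_or_ccw_of_genPos hgp (hT hu) (hT hw) hx huw (by rintro rfl; exact hxT hu)
      (by rintro rfl; exact hxT hw)).resolve_right fun h' => ?_
    exact notMem_convexHull_of_ccw h h'.rotate.rotate hxc
  have nonneg : ∀ {i j k : Pt}, Ccw i j k → 0 ≤ det i j k := le_of_lt
  have left : ∀ i j : Pt, det i j i = 0 := fun i j => by simp [det]
  have right : ∀ i j : Pt, det i j j = 0 := fun i j => by simp only [det]; ring
  have hQP : hullVerts P ⊆ P := Finset.filter_subset _ _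
  have hTR : hullVerts (P \ hullVerts P) ⊆ P \ hullVerts P := Finset.filter_subset _ _
  obtain ⟨p, q, r, s, hQ, hpqr, hqrs, hrsp, hspq⟩ := exists_ccw_quad h1
    (fun x hx y hy z hz => hgp x (hQP hx) y (hQP hy) z (hQP hz)) (convexPos_hullVerts P)
  obtain ⟨a, b, c, hT, habc⟩ : ∃ a b c, hullVerts (P \ hullVerts P) = {a, b, c} ∧ Ccw a b c := by
    obtain ⟨a, b, c, hab, hac, hbc, hT⟩ := Finset.card_eq_three.1 h2
    have hTP : ∀ x ∈ hullVerts (P \ hullVerts P), x ∈ P := fun x hx =>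
      (Finset.mem_sdiff.1 (hTR hx)).1
    rcases ccw_or_ccw_of_genPos hgp (hTP a (by simp [hT])) (hTP b (by simp [hT]))
      (hTP c (by simp [hT])) hab hac hbc with h | h
    · exact ⟨a, b, c, hT, h⟩
    · exact ⟨a, c, b, by rw [hT, Finset.pair_comm], h⟩
  obtain ⟨d, e, hde, hI⟩ : ∃ d e, d ≠ e ∧
      (P \ hullVerts P) \ hullVerts (P \ hullVerts P) = {d, e} := by
    rw [← Finset.card_eq_two, Finset.card_sdiff_of_subset hTR, Finset.card_sdiff_of_subset hQP]
    omega
  have hquad : ∀ x ∈ P \ hullVerts P, InQuad p q r s x := by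
    intro x hx
    obtain ⟨hxP, hxQ⟩ := Finset.mem_sdiff.1 hx
    have hxc : x ∈ convexHull ℝ (hullVerts P : Set Pt) :=
      convexHull_hullVerts P ▸ subset_convexHull ℝ _ hxP
    refine ⟨strict hQP ?_ ?_ hpqr.ne_left hxP hxQ hxc ?_,
      strict hQP ?_ ?_ hqrs.ne_left hxP hxQ hxc ?_, strict hQP ?_ ?_ hrsp.ne_left hxP hxQ hxc ?_,
      strict hQP ?_ ?_ hspq.ne_left hxP hxQ hxc ?_⟩ <;>
    simp [hQ, left, right, nonneg, hpqr, hqrs, hrsp, hspq, hpqr.rotate, hqrs.rotate, hrsp.rotate,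
      hspq.rotate]
  have htri : ∀ x ∈ (P \ hullVerts P) \ hullVerts (P \ hullVerts P), InTriangle a b c x := by
    intro x hx
    obtain ⟨hxR, hxT⟩ := Finset.mem_sdiff.1 hx
    have hxP := (Finset.mem_sdiff.1 hxR).1
    have hTP := hTR.trans (Finset.sdiff_subset (s := P))
    have hxc : x ∈ convexHull ℝ (hullVerts (P \ hullVerts P) : Set Pt) :=
      convexHull_hullVerts (P \ hullVerts P) ▸ subset_convexHull ℝ _ hxR
    refine ⟨strict hTP ?_ ?_ habc.ne_left hxP hxT hxc ?_,
      strict hTP ?_ ?_ habc.rotate.ne_left hxP hxT hxc ?_,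
      strict hTP ?_ ?_ habc.rotate.rotate.ne_left hxP hxT hxc ?_⟩ <;>
    simp [hT, left, right, nonneg, habc, habc.rotate, habc.rotate.rotate]
  have hRmem : ∀ x, x ∈ P \ hullVerts P ↔ x = a ∨ x = b ∨ x = c ∨ x = d ∨ x = e := by
    intro x
    rw [← Finset.union_sdiff_of_subset hTR, hI, hT]
    simp only [Finset.mem_union, Finset.mem_insert, Finset.mem_singleton]
    tauto
  have hmem : ∀ x, x ∈ P ↔
      x = a ∨ x = b ∨ x = c ∨ x = d ∨ x = e ∨ x = p ∨ x = q ∨ x = r ∨ x = s := by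
    intro x
    rw [← Finset.sdiff_union_of_subset hQP, Finset.mem_union, hRmem, hQ]
    simp only [Finset.mem_insert, Finset.mem_singleton]
    tauto
  have layered : IsLayered P a b c d e p q r s :=
    { mem_iff := hmem
      genPos := hgp
      triangle := habc
      triangle_d := htri d (by simp [hI])
      triangle_e := htri e (by simp [hI])
      pqr := hpqr
      qrs := hqrs
      rsp := hrsp
      spq := hspq
      quad_a := hquad a (by simp [hRmem])
      quad_b := hquad b (by simp [hRmem])
      quad_c := hquad c (by simp [hRmem])
      quad_d := hquad d (by simp [hRmem])
      quad_e := hquad e (by simp [hRmem]) }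
  exact layered.exists_emptyConvexPentagon hde
end
end
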